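/- Fix 0 < δ < 1 and r ≥ 1. Let u_β(x) = (a(β,r) + x/(r a(β,r))) β^{-1} with a(β,r) as in Theorem 2.1 of the paper, and fix 0 < ε < (1-δ)/(1+δ). Then β^{-ε} · Σ_{j ≥ u_β(x)} (jβ)^{-2(r-1)} exp(-r(jβ)²/(1+δ)) → 0 as β → 0. -/

import Mathlib

open Filter Real

noncomputable def aOrd (d r : ℕ) (β : ℝ) : ℝ :=
  Real.sqrt ((2 / r) * (Real.log β⁻¹ -
    (((r : ℝ) + 1) / 2) * Real.log ((2 / r) * Real.log β⁻¹) +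
    Real.log ((d.choose r : ℝ) * (r : ℝ)⁻¹ * (2 * π) ^ (-(r : ℝ) / 2))))

noncomputable def uOrd (d r : ℕ) (β x : ℝ) : ℝ :=
  (aOrd d r β + x / (r * aOrd d r β)) / β


lemma lin_log_atTop (κ q A B : ℝ) (hκ : 0 < κ) (hq : 0 < q) :
    Tendsto (fun L : ℝ => κ * L - A * Real.log (q * L) + B) atTop atTop := by
  have h1 : Tendsto (fun M : ℝ => Real.log M / M) atTop (nhds 0) := by
    simpa using Real.tendsto_pow_log_div_mul_add_atTop 1 0 1 one_ne_zero
  have h2 : Tendsto (fun M : ℝ => κ / q - A * (Real.log M / M)) atTop (nhds (κ / q)) := by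
    simpa using (tendsto_const_nhds (x := κ / q)).sub (h1.const_mul A)
  have h3 : Tendsto (fun M : ℝ => M * (κ / q - A * (Real.log M / M)) + B) atTop atTop :=
    tendsto_atTop_add_const_right _ _ (tendsto_id.atTop_mul_pos (div_pos hκ hq) h2)
  have h4 : Tendsto (fun L : ℝ => q * L) atTop atTop := tendsto_id.const_mul_atTop hq
  refine (h3.comp h4).congr' ?_
  filter_upwards [eventually_gt_atTop 0] with L hL
  simp only [Function.comp]
  field_simp

noncomputable def ceilEquiv (u : ℝ) : ℕ ≃ {j : ℤ // u ≤ (j : ℝ)} where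
  toFun n := ⟨⌈u⌉ + n, by
    push_cast
    have := Int.le_ceil u
    have h : (0 : ℝ) ≤ n := n.cast_nonneg
    linarith⟩
  invFun j := ((j : ℤ) - ⌈u⌉).toNat
  left_inv n := by simp
  right_inv j := by
    have : ⌈u⌉ ≤ (j : ℤ) := Int.ceil_le.2 j.2
    apply Subtype.ext
    simp only
    omega

lemma sum_bound (r m : ℕ) (hr : 1 ≤ r) (δ β u : ℝ) (hδ0 : 0 < δ) (hβ : 0 < β) (hβ1 : β ≤ 1)
    (hu : 1 ≤ u * β) :
    ∑' j : {j : ℤ // u ≤ (j : ℝ)},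
          ((((j : ℤ) : ℝ) * β) ^ m)⁻¹ *
            Real.exp (-(r : ℝ) * (((j : ℤ) : ℝ) * β) ^ 2 / (1 + δ)) ≤
      Real.exp (-((r : ℝ) / (1 + δ)) * (u * β) ^ 2) *
        ((1 + (r : ℝ) / (1 + δ)) / ((r : ℝ) / (1 + δ) * β)) := by
  have hr0 : (0 : ℝ) < r := by exact_mod_cast hr
  have hexp : ∀ y : ℝ, -(r : ℝ) * y ^ 2 / (1 + δ) = -((r : ℝ) / (1 + δ)) * y ^ 2 := by
    intro y; ring
  have hc : 0 < (r : ℝ) / (1 + δ) := by positivity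
  simp only [hexp]
  generalize (r : ℝ) / (1 + δ) = c at *
  rw [← (ceilEquiv u).tsum_eq]
  have hq1 : Real.exp (-(c * β)) < 1 := by
    rw [Real.exp_lt_one_iff]
    have := mul_pos hc hβ
    linarith
  have hgeo := (hasSum_geometric_of_lt_one (Real.exp_pos _).le hq1).mul_left
    (Real.exp (-c * (u * β) ^ 2))
  have hterm : ∀ n : ℕ, (((((ceilEquiv u n : {j : ℤ // u ≤ (j : ℝ)}) : ℤ) : ℝ) * β) ^ m)⁻¹ *
      Real.exp (-c * ((((ceilEquiv u n : {j : ℤ // u ≤ (j : ℝ)}) : ℤ) : ℝ) * β) ^ 2) ≤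
      Real.exp (-c * (u * β) ^ 2) * Real.exp (-(c * β)) ^ n := by
    intro n
    have hj : u + n ≤ (((ceilEquiv u n : {j : ℤ // u ≤ (j : ℝ)}) : ℤ) : ℝ) := by
      have := Int.le_ceil u
      simp only [ceilEquiv, Equiv.coe_fn_mk]
      push_cast
      linarith
    generalize (((ceilEquiv u n : {j : ℤ // u ≤ (j : ℝ)}) : ℤ) : ℝ) = j at *
    have hn : (0 : ℝ) ≤ n := n.cast_nonneg
    have hnb : 0 ≤ n * β := by positivity
    have hy : u * β + n * β ≤ j * β := by nlinarith
    have h1 : 1 ≤ j * β := by linarith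
    have hinv : ((j * β) ^ m)⁻¹ ≤ 1 := inv_le_one_of_one_le₀ (one_le_pow₀ h1)
    rw [← Real.exp_nat_mul, ← Real.exp_add]
    have hsq : (u * β) ^ 2 + n * β ≤ (j * β) ^ 2 := by nlinarith
    calc _ ≤ 1 * Real.exp (-c * (j * β) ^ 2) := by gcongr
      _ ≤ _ := by
        rw [one_mul]
        apply Real.exp_le_exp.2
        nlinarith
  have hnn : ∀ n : ℕ, 0 ≤ (((((ceilEquiv u n : {j : ℤ // u ≤ (j : ℝ)}) : ℤ) : ℝ) * β) ^ m)⁻¹ *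
      Real.exp (-c * ((((ceilEquiv u n : {j : ℤ // u ≤ (j : ℝ)}) : ℤ) : ℝ) * β) ^ 2) := by
    intro n
    have hj : 0 ≤ (((ceilEquiv u n : {j : ℤ // u ≤ (j : ℝ)}) : ℤ) : ℝ) * β := by
      have := (ceilEquiv u n).2
      nlinarith
    positivity
  have hsum := Summable.of_nonneg_of_le hnn hterm hgeo.summable
  refine (hsum.tsum_le_tsum hterm hgeo.summable).trans ?_
  rw [hgeo.tsum_eq]
  gcongr
  have hcb := mul_pos hc hβ
  have h5 : Real.exp (-(c * β)) ≤ (1 + c * β)⁻¹ := by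
    rw [Real.exp_neg]
    gcongr
    linarith [Real.add_one_le_exp (c * β)]
  have h6 : c * β / (1 + c) ≤ 1 - Real.exp (-(c * β)) := by
    have h7 : c * β / (1 + c) ≤ c * β / (1 + c * β) := by
      gcongr
      nlinarith
    have h8 : c * β / (1 + c * β) = 1 - (1 + c * β)⁻¹ := by field_simp; ring
    linarith
  calc _ ≤ (c * β / (1 + c))⁻¹ := by gcongr
    _ = _ := by rw [inv_div]

/-- The short-range term estimate: for fixed `0 < δ < 1` and `0 < ε < (1-δ)/(1+δ)`,
`β^{-ε} Σ_{j ≥ u_β(x)} (jβ)^{-2(r-1)} exp(-r(jβ)²/(1+δ)) → 0` as `β → 0⁺`. -/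
theorem short_range_term_tendsto_zero
    (d r : ℕ) (hr : 1 ≤ r) (hrd : r ≤ d) (δ ε : ℝ)
    (hδ0 : 0 < δ) (hδ1 : δ < 1) (hε0 : 0 < ε) (hε : ε < (1 - δ) / (1 + δ)) (x : ℝ) :
    Tendsto (fun β : ℝ =>
        β ^ (-ε) * ∑' j : {j : ℤ // uOrd d r β x ≤ (j : ℝ)},
          ((((j : ℤ) : ℝ) * β) ^ (2 * (r - 1)))⁻¹ *
            Real.exp (-(r : ℝ) * (((j : ℤ) : ℝ) * β) ^ 2 / (1 + δ)))
      (nhdsWithin 0 (Set.Ioi 0)) (nhds 0) := by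
  have hr0 : (0 : ℝ) < r := by exact_mod_cast hr
  have hL : Tendsto (fun β : ℝ => Real.log β⁻¹) (nhdsWithin 0 (Set.Ioi 0)) atTop :=
    Real.tendsto_log_atTop.comp tendsto_inv_nhdsGT_zero
  set C := Real.log ((d.choose r : ℝ) * (r : ℝ)⁻¹ * (2 * π) ^ (-(r : ℝ) / 2)) with hC
  set S : ℝ → ℝ := fun β => (2 / r) * (Real.log β⁻¹ -
    (((r : ℝ) + 1) / 2) * Real.log ((2 / r) * Real.log β⁻¹) + C) with hS
  have hSt : Tendsto S (nhdsWithin 0 (Set.Ioi 0)) atTop := by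
    have := (lin_log_atTop 1 (2 / r) (((r : ℝ) + 1) / 2) C one_pos (by positivity)).comp hL
    have h2 := this.const_mul_atTop (show (0 : ℝ) < 2 / r by positivity)
    refine h2.congr fun β => ?_
    simp [hS]
  have haS : ∀ β, aOrd d r β = Real.sqrt (S β) := fun β => rfl
  have hat : Tendsto (fun β => aOrd d r β) (nhdsWithin 0 (Set.Ioi 0)) atTop :=
    Real.tendsto_sqrt_atTop.comp hSt
  have hvt : Tendsto (fun β => aOrd d r β + x / (r * aOrd d r β))
      (nhdsWithin 0 (Set.Ioi 0)) atTop := by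
    have h1 : Tendsto (fun β => x / (r * aOrd d r β)) (nhdsWithin 0 (Set.Ioi 0)) (nhds 0) :=
      (hat.const_mul_atTop hr0).const_div_atTop x
    exact hat.atTop_add h1
  have hδ : 0 < 1 + δ := by linarith
  have hκ : 0 < 2 / (1 + δ) - 1 - ε := by
    have : (1 - δ) / (1 + δ) = 2 / (1 + δ) - 1 := by field_simp; ring
    linarith
  have hE := (lin_log_atTop (2 / (1 + δ) - 1 - ε) (2 / r) (2 / (1 + δ) * (((r : ℝ) + 1) / 2))
    (2 / (1 + δ) * (C + x)) hκ (by positivity)).comp hL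
  set K : ℝ := (1 + (r : ℝ) / (1 + δ)) / ((r : ℝ) / (1 + δ)) with hK
  have hlim := (Real.tendsto_exp_neg_atTop_nhds_zero.comp hE).const_mul K
  rw [mul_zero] at hlim
  have hpos : ∀ᶠ β : ℝ in nhdsWithin 0 (Set.Ioi 0), 0 < β := self_mem_nhdsWithin
  have hle1 : ∀ᶠ β : ℝ in nhdsWithin 0 (Set.Ioi 0), β < 1 :=
    (eventually_lt_nhds one_pos).filter_mono nhdsWithin_le_nhds
  refine squeeze_zero' ?_ ?_ hlim
  · filter_upwards [hpos] with β hβ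
    refine mul_nonneg (Real.rpow_nonneg hβ.le _) (tsum_nonneg fun j => ?_)
    refine mul_nonneg (inv_nonneg.2 ?_) (Real.exp_pos _).le
    rw [pow_mul]
    positivity
  · filter_upwards [hpos, hle1, hSt.eventually_gt_atTop 0, hvt.eventually_ge_atTop 1]
      with β hβ hβ1 hSβ hv
    have huv : uOrd d r β x * β = aOrd d r β + x / (r * aOrd d r β) := by
      rw [uOrd, div_mul_cancel₀ _ hβ.ne']
    have hb := sum_bound r (2 * (r - 1)) hr δ β (uOrd d r β x) hδ0 hβ hβ1.le (by rw [huv]; exact hv)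
    have ha : 0 < aOrd d r β := by rw [haS]; exact Real.sqrt_pos.2 hSβ
    have hsq : aOrd d r β ^ 2 = S β := by rw [haS]; exact Real.sq_sqrt hSβ.le
    have hv2 : S β + 2 * x / r ≤ (uOrd d r β x * β) ^ 2 := by
      have : (uOrd d r β x * β) ^ 2 = S β + 2 * x / r + (x / (r * aOrd d r β)) ^ 2 := by
        rw [huv, ← hsq]; field_simp; ring
      rw [this]
      linarith [sq_nonneg (x / (r * aOrd d r β))]
    refine (mul_le_mul_of_nonneg_left hb (Real.rpow_nonneg hβ.le _)).trans ?_
    have hrp : β ^ (-ε) = Real.exp (ε * Real.log β⁻¹) := by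
      rw [Real.rpow_def_of_pos hβ, Real.log_inv]; congr 1; ring
    have hbi : β⁻¹ = Real.exp (Real.log β⁻¹) := (Real.exp_log (inv_pos.2 hβ)).symm
    have hK0 : 0 ≤ K := by positivity
    calc _ = K * (Real.exp (ε * Real.log β⁻¹) *
          Real.exp (-((r : ℝ) / (1 + δ)) * (uOrd d r β x * β) ^ 2) * β⁻¹) := by
          rw [hrp, hK]; field_simp
      _ = K * Real.exp (ε * Real.log β⁻¹ + -((r : ℝ) / (1 + δ)) * (uOrd d r β x * β) ^ 2
          + Real.log β⁻¹) := by
          rw [Real.exp_add, Real.exp_add, ← hbi]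
      _ ≤ _ := by
          refine mul_le_mul_of_nonneg_left (Real.exp_le_exp.2 ?_) hK0
          have h9 := mul_le_mul_of_nonneg_left hv2 (show 0 ≤ (r : ℝ) / (1 + δ) by positivity)
          have h10 : (r : ℝ) / (1 + δ) * (S β + 2 * x / r) = 2 / (1 + δ) * (Real.log β⁻¹ -
              (((r : ℝ) + 1) / 2) * Real.log ((2 / r) * Real.log β⁻¹) + C + x) := by
            simp only [hS]
            field_simp
          rw [h10] at h9
          simp only [Function.comp]
          linarith
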